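/- arXiv:1612.05620 — 2 statements merged into one kernel-verified Lean document; each statement's English description precedes it below -/
import Mathlib

section
/- Let p satisfy 1 ≤ p < 4 and let v̄ := z₂ ∘ F. Then v̄ is not a local extremum point of K with respect to the norm ‖·‖_p: for every δ > 0 there exist h₁, h₂ ∈ C₀[a,b] with 0 < ‖h₁‖_p < δ, 0 < ‖h₂‖_p < δ, K(v̄ + h₁) < K(v̄), and K(v̄ + h₂) > K(v̄). -/
open Set MeasureTheory intervalIntegral

/-- The supremum norm of `h` on `[a,b]`. -/
noncomputable def supN (a b : ℝ) (h : ℝ → ℝ) : ℝ := sSup ((fun x => |h x|) '' Set.Icc a b)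

/-- The `p`-norm (`1 ≤ p < ∞`) of `h` on `[a,b]`. -/
noncomputable def pN (a b p : ℝ) (h : ℝ → ℝ) : ℝ :=
  (∫ x in a..b, |h x| ^ p) ^ (1 / p)

/-- `C₀[a,b]`: continuous functions on `[a,b]` vanishing at the endpoints. -/
def C0 (a b : ℝ) (h : ℝ → ℝ) : Prop := ContinuousOn h (Set.Icc a b) ∧ h a = 0 ∧ h b = 0

/-- The functional `K(v) = ∫_a^b θ(x) (H(v(x)) - F(x) v(x)) dx`,
with `H(y) = (1/2)((1/2)y² - λ)²`. -/
noncomputable def Kf (a b lam : ℝ) (θ F : ℝ → ℝ) (v : ℝ → ℝ) : ℝ :=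
  ∫ x in a..b, θ x * ((1/2) * ((1/2) * v x ^ 2 - lam) ^ 2 - F x * v x)

/-- The tent function. -/
noncomputable def tent (t : ℝ) : ℝ := max 0 (1 - |t|)

/-- The rescaled tent function. -/
noncomputable def tentw (x0 w x : ℝ) : ℝ := tent ((x - x0) / w)

lemma tent_cont : Continuous tent := by unfold tent; fun_prop

lemma tent_nonneg (t : ℝ) : 0 ≤ tent t := le_max_left _ _

lemma tent_le_one (t : ℝ) : tent t ≤ 1 := by
  unfold tent
  exact max_le zero_le_one (by linarith [abs_nonneg t])

lemma tent_zero_of (t : ℝ) (h : 1 ≤ |t|) : tent t = 0 := by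
  unfold tent
  exact max_eq_left (by linarith)

lemma tent_supp : HasCompactSupport tent := by
  apply HasCompactSupport.of_support_subset_isCompact (isCompact_Icc (a := (-1:ℝ)) (b := 1))
  intro t ht
  rw [Function.mem_support] at ht
  by_contra hc
  apply ht
  apply tent_zero_of
  by_contra h
  push Not at h
  exact hc ⟨(abs_lt.1 h).1.le, (abs_lt.1 h).2.le⟩

lemma tent_int_pos (G : ℝ → ℝ) (hG : Continuous G) (h0 : G 0 = 0) (hn : ∀ t, 0 ≤ G t)
    (h1 : G 1 ≠ 0) : 0 < ∫ t, G (tent t) := by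
  apply Continuous.integral_pos_of_hasCompactSupport_nonneg_nonzero (x := 0)
  · exact hG.comp tent_cont
  · exact tent_supp.comp_left h0
  · intro t; exact hn _
  · simpa [tent] using h1

lemma tentw_zero_of {a b w : ℝ} (hw : 0 < w) (hwab : w ≤ (b - a) / 2) {x : ℝ}
    (hx : x ∉ Ioo a b) : tentw ((a + b) / 2) w x = 0 := by
  unfold tentw
  apply tent_zero_of
  rw [abs_div, abs_of_pos hw, le_div_iff₀ hw, one_mul, le_abs]
  by_contra hc
  push Not at hc
  exact hx ⟨by linarith [hc.2], by linarith [hc.1]⟩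

lemma tentw_int {a b w : ℝ} (hw : 0 < w) (hwab : w ≤ (b - a) / 2)
    (G : ℝ → ℝ) (h0 : G 0 = 0) :
    ∫ x in a..b, G (tentw ((a + b) / 2) w x) = w * ∫ t, G (tent t) := by
  rw [intervalIntegral.integral_eq_integral_of_support_subset]
  · unfold tentw
    rw [MeasureTheory.integral_sub_right_eq_self (fun x => G (tent (x / w))) ((a + b) / 2),
      MeasureTheory.Measure.integral_comp_div (fun t => G (tent t)) w]
    simp [abs_of_pos hw]
  · intro x hx
    rw [Function.mem_support] at hx
    by_contra hc
    apply hx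
    rw [tentw_zero_of hw hwab (fun h => hc (Ioo_subset_Ioc_self h)), h0]

lemma tentw_cont (x0 w : ℝ) : Continuous (tentw x0 w) := by
  unfold tentw
  exact tent_cont.comp (by fun_prop)

lemma tent_C0 {a b w : ℝ} (c : ℝ) (hw : 0 < w) (hwab : w ≤ (b - a) / 2) :
    C0 a b (fun x => c * tentw ((a + b) / 2) w x) := by
  refine ⟨(continuous_const.mul (tentw_cont _ _)).continuousOn, ?_, ?_⟩
  · simp [tentw_zero_of hw hwab (x := a) (by simp)]
  · simp [tentw_zero_of hw hwab (x := b) (by simp)]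

lemma tent_pN {a b c p δ : ℝ} (hab : a < b) (hc : 0 < c) (hp : 1 ≤ p) (hδ : 0 < δ) :
    ∃ w, 0 < w ∧ w ≤ (b - a) / 2 ∧ 0 < pN a b p (fun x => c * tentw ((a + b) / 2) w x) ∧
      pN a b p (fun x => c * tentw ((a + b) / 2) w x) < δ := by
  have hp0 : 0 < p := by linarith
  have hz : |c * 0| ^ p = 0 := by simp [Real.zero_rpow hp0.ne']
  have hJ : 0 < ∫ t, |c * tent t| ^ p := by
    apply tent_int_pos (fun y => |c * y| ^ p)
    · exact Continuous.rpow_const (by fun_prop) (fun _ => Or.inr hp0.le)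
    · exact hz
    · intro t; positivity
    · simp only [mul_one]; positivity
  set J := ∫ t, |c * tent t| ^ p with hJd
  have hd : 0 < δ ^ p := Real.rpow_pos_of_pos hδ p
  refine ⟨min ((b - a) / 2) (δ ^ p / (2 * J)), ?_, min_le_left _ _, ?_⟩
  · exact lt_min (by linarith) (by positivity)
  have hw : 0 < min ((b - a) / 2) (δ ^ p / (2 * J)) := lt_min (by linarith) (by positivity)
  have hw1 := min_le_left ((b - a) / 2) (δ ^ p / (2 * J))
  have hw2 := min_le_right ((b - a) / 2) (δ ^ p / (2 * J))
  set w := min ((b - a) / 2) (δ ^ p / (2 * J))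
  unfold pN
  rw [tentw_int hw hw1 (fun y => |c * y| ^ p) hz, ← hJd]
  refine ⟨by positivity, ?_⟩
  rw [one_div, Real.rpow_inv_lt_iff_of_pos (by positivity) hδ.le hp0]
  rw [le_div_iff₀ (by positivity)] at hw2
  nlinarith

lemma Kf_diff {a b lam : ℝ} (hab : a ≤ b) {θ F v h : ℝ → ℝ} (hθ : ContinuousOn θ (Icc a b))
    (hF : ContinuousOn F (Icc a b)) (hv : ContinuousOn v (Icc a b))
    (hh : ContinuousOn h (Icc a b))
    (hcrit : ∀ x ∈ Icc a b, v x * ((1/2) * (v x) ^ 2 - lam) = F x) :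
    Kf a b lam θ F (v + h) - Kf a b lam θ F v =
      ∫ x in a..b, θ x * ((1/2) * (3/2 * v x ^ 2 - lam) * h x ^ 2 + (1/2) * v x * h x ^ 3
        + (1/8) * h x ^ 4) := by
  unfold Kf
  rw [← intervalIntegral.integral_sub]
  · apply intervalIntegral.integral_congr
    intro x hx
    rw [uIcc_of_le hab] at hx
    simp only [Pi.add_apply]
    rw [← hcrit x hx]
    ring
  · apply ContinuousOn.intervalIntegrable
    rw [uIcc_of_le hab]
    simp only [Pi.add_apply]
    fun_prop
  · apply ContinuousOn.intervalIntegrable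
    rw [uIcc_of_le hab]
    fun_prop

lemma big_c (A B C : ℝ) (hA : 0 < A) (hB : 0 ≤ B) (hC : 0 ≤ C) :
    ∃ c > 0, 0 < A * c ^ 4 - B * c ^ 3 - C * c ^ 2 := by
  refine ⟨(B + C) / A + 1, by positivity, ?_⟩
  set c := (B + C) / A + 1 with hc
  have h1 : 1 ≤ c := by rw [hc]; linarith [show 0 ≤ (B + C) / A by positivity]
  have h2 : A * c = B + C + A := by rw [hc]; field_simp
  have h3 : A * c ^ 4 - B * c ^ 3 - C * c ^ 2 = c ^ 2 * ((A * c) * c - B * c - C) := by ring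
  rw [h3, h2]
  have : 0 < c := by linarith
  apply mul_pos (by positivity)
  nlinarith

set_option maxHeartbeats 1000000 in
theorem stmt9 (a b lam : ℝ) (hab : a < b) (hlam : 0 < lam)
    (θ : ℝ → ℝ) (hθc : ContinuousOn θ (Set.Icc a b)) (hθ : ∀ x ∈ Set.Icc a b, 0 < θ x)
    (F : ℝ → ℝ) (hF : ContDiffOn ℝ 1 F (Set.Icc a b)) (hFa : F a = 0) (hFb : F b = 0)
    (hFne : ∀ x ∈ Set.Ioo a b, F x ≠ 0)
    (hFsmall : supN a b F < (2 * lam / 3) ^ ((3 : ℝ) / 2))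
    (κ : ℝ) (hκ : κ = Real.sqrt (2 * lam / 3))
    (z₂ : ℝ → ℝ)
    (hz₂ : ∀ A ∈ Set.Ioo (-κ ^ 3) (κ ^ 3),
      z₂ A ∈ Set.Ioo (-κ) κ ∧ z₂ A * ((1/2) * (z₂ A) ^ 2 - lam) = A ∧
      ∀ z ∈ Set.Ioo (-κ) κ, z * ((1/2) * z ^ 2 - lam) = A → z = z₂ A)
    (p : ℝ) (hp1 : 1 ≤ p) (hp4 : p < 4) :
    ∀ δ > 0, ∃ h₁ h₂ : ℝ → ℝ, C0 a b h₁ ∧ C0 a b h₂ ∧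
      0 < pN a b p h₁ ∧ pN a b p h₁ < δ ∧ 0 < pN a b p h₂ ∧ pN a b p h₂ < δ ∧
      Kf a b lam θ F ((fun x => z₂ (F x)) + h₁) < Kf a b lam θ F (fun x => z₂ (F x)) ∧
      Kf a b lam θ F ((fun x => z₂ (F x)) + h₂) > Kf a b lam θ F (fun x => z₂ (F x)) := by
  intro δ hδ
  have hle : a ≤ b := hab.le
  have hFc : ContinuousOn F (Icc a b) := hF.continuousOn
  have hκ0 : 0 < κ := by rw [hκ]; positivity
  have hκ2 : κ ^ 2 = 2 * lam / 3 := by rw [hκ]; exact Real.sq_sqrt (by positivity)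
  have hκ3 : (2 * lam / 3) ^ ((3 : ℝ) / 2) = κ ^ 3 := by
    rw [← hκ2, ← Real.rpow_natCast κ 2, ← Real.rpow_mul hκ0.le, ← Real.rpow_natCast κ 3]
    norm_num
  rw [hκ3] at hFsmall
  set s := supN a b F with hs
  have hFs : ∀ x ∈ Icc a b, |F x| ≤ s := by
    intro x hx
    exact le_csSup (isCompact_Icc.image_of_continuousOn hFc.abs).bddAbove ⟨x, hx, rfl⟩
  have hz : ∀ x ∈ Icc a b, z₂ (F x) ∈ Ioo (-κ) κ ∧
      z₂ (F x) * ((1/2) * (z₂ (F x)) ^ 2 - lam) = F x := by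
    intro x hx
    have := abs_lt.1 ((hFs x hx).trans_lt hFsmall)
    obtain ⟨h1, h2, -⟩ := hz₂ (F x) ⟨this.1, this.2⟩
    exact ⟨h1, h2⟩
  set v : ℝ → ℝ := fun x => z₂ (F x) with hv
  have hcrit : ∀ x ∈ Icc a b, v x * ((1/2) * (v x) ^ 2 - lam) = F x := fun x hx => (hz x hx).2
  have hvκ : ∀ x ∈ Icc a b, |v x| < κ := fun x hx => abs_lt.2 (hz x hx).1
  obtain ⟨γ, hγ, hγv⟩ : ∃ γ > 0, ∀ x ∈ Icc a b, γ ≤ lam - 3/2 * v x ^ 2 := by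
    refine ⟨(κ ^ 3 - s) / κ, div_pos (by linarith) hκ0, ?_⟩
    intro x hx
    have h1 := hvκ x hx
    have h2 := hFs x hx
    rw [← hcrit x hx, abs_mul] at h2
    rw [div_le_iff₀ hκ0]
    have h3 := abs_nonneg (v x)
    rw [← sq_abs (v x)] at h2 ⊢
    set t := |v x|
    have hl : lam = 3/2 * κ ^ 2 := by linarith
    rw [hl] at h2 ⊢
    have h4 : |1 / 2 * t ^ 2 - 3 / 2 * κ ^ 2| = 3 / 2 * κ ^ 2 - 1 / 2 * t ^ 2 := by
      rw [abs_of_nonpos (by nlinarith)]; ring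
    rw [h4] at h2
    have h5 : κ ^ 3 - t * (3 / 2 * κ ^ 2 - 1 / 2 * t ^ 2) = (κ - t) * (1/2 * (κ - t) * (2 * κ + t)) := by
      ring
    have h6 : (3 / 2 * κ ^ 2 - 3 / 2 * t ^ 2) * κ = (κ - t) * (3 / 2 * (κ + t) * κ) := by ring
    rw [h6]
    have h7 : (κ - t) * (1/2 * (κ - t) * (2 * κ + t)) ≤ (κ - t) * (3 / 2 * (κ + t) * κ) := by
      apply mul_le_mul_of_nonneg_left _ (by linarith)
      nlinarith [mul_nonneg h3 hκ0.le]
    linarith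
  have hvc : ContinuousOn v (Icc a b) := by
    have hlip : ∀ x ∈ Icc a b, ∀ y ∈ Icc a b, γ * |v x - v y| ≤ |F x - F y| := by
      intro x hx y hy
      rw [← hcrit x hx, ← hcrit y hy]
      have e : v x * (1 / 2 * v x ^ 2 - lam) - v y * (1 / 2 * v y ^ 2 - lam) =
        -((lam - (v x ^ 2 + v x * v y + v y ^ 2) / 2) * (v x - v y)) := by ring
      rw [e, abs_neg, abs_mul]
      apply mul_le_mul_of_nonneg_right _ (abs_nonneg _)
      apply le_trans _ (le_abs_self _)
      nlinarith [hγv x hx, hγv y hy, sq_nonneg (v x - v y)]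
    rw [Metric.continuousOn_iff] at hFc ⊢
    intro x hx ε hε
    obtain ⟨η, hη, H⟩ := hFc x hx (γ * ε) (by positivity)
    refine ⟨η, hη, fun y hy hd => ?_⟩
    have h1 := H y hy hd
    have h2 := hlip y hy x hx
    rw [Real.dist_eq] at h1 ⊢
    exact lt_of_mul_lt_mul_left (h2.trans_lt h1) hγ.le
  obtain ⟨x₁, hx₁, hm⟩ := isCompact_Icc.exists_isMinOn (nonempty_Icc.2 hle) hθc
  obtain ⟨x₂, hx₂, hM⟩ := isCompact_Icc.exists_isMaxOn (nonempty_Icc.2 hle) hθc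
  have hm0 := hθ x₁ hx₁
  have hT0 := hθ x₂ hx₂
  set m := θ x₁
  set T := θ x₂
  have hm' : ∀ x ∈ Icc a b, m ≤ θ x := fun x hx => hm hx
  have hM' : ∀ x ∈ Icc a b, θ x ≤ T := fun x hx => hM hx
  obtain ⟨c₁, hc₁, hc₁'⟩ : ∃ c > 0, (1/2) * κ * c + (1/8) * c ^ 2 ≤ γ / 4 := by
    refine ⟨min 1 (γ / (4 * (κ + 1))), by positivity, ?_⟩
    have h0 : 0 < min 1 (γ / (4 * (κ + 1))) := by positivity
    have h1 := min_le_left 1 (γ / (4 * (κ + 1)))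
    have h2 := min_le_right 1 (γ / (4 * (κ + 1)))
    rw [le_div_iff₀ (by positivity)] at h2
    nlinarith
  have hJ : ∀ k : ℕ, k ≠ 0 → Even k → 0 < ∫ t, tent t ^ k := fun k hk hke =>
    tent_int_pos (fun y => y ^ k) (by fun_prop) (by simp [hk]) (fun t => hke.pow_nonneg t)
      (by simp)
  have hJ3 : 0 ≤ ∫ t, tent t ^ 3 := integral_nonneg fun t => pow_nonneg (tent_nonneg t) 3
  have hJ2 := hJ 2 (by norm_num) (by decide)
  have hJ4 := hJ 4 (by norm_num) (by decide)
  obtain ⟨c₂, hc₂, hc₂'⟩ := big_c (m / 8 * ∫ t, tent t ^ 4) (T * κ / 2 * ∫ t, tent t ^ 3)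
    (T * lam / 2 * ∫ t, tent t ^ 2) (by positivity) (by positivity) (by positivity)
  obtain ⟨w₁, hw₁, hw₁', hp₁, hp₁'⟩ := tent_pN hab hc₁ hp1 hδ
  obtain ⟨w₂, hw₂, hw₂', hp₂, hp₂'⟩ := tent_pN hab hc₂ hp1 hδ
  have hi1 := fun k (hk : k ≠ 0) => tentw_int hw₁ hw₁' (fun y => y ^ k) (zero_pow hk)
  have hi2 := fun k (hk : k ≠ 0) => tentw_int hw₂ hw₂' (fun y => y ^ k) (zero_pow hk)
  have hC1 := tent_C0 c₁ hw₁ hw₁'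
  have hC2 := tent_C0 c₂ hw₂ hw₂'
  refine ⟨_, _, hC1, hC2, hp₁, hp₁', hp₂, hp₂', ?_, ?_⟩
  · have hd := Kf_diff hle hθc hFc hvc hC1.1 hcrit
    have hb : (∫ x in a..b, θ x * ((1/2) * (3/2 * v x ^ 2 - lam) * (c₁ * tentw ((a + b) / 2) w₁ x) ^ 2
        + (1/2) * v x * (c₁ * tentw ((a + b) / 2) w₁ x) ^ 3
        + (1/8) * (c₁ * tentw ((a + b) / 2) w₁ x) ^ 4)) ≤
        ∫ x in a..b, -(m * (γ / 4) * c₁ ^ 2) * (tentw ((a + b) / 2) w₁ x) ^ 2 := by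
      have hcc := hC1.1
      have htc := (tentw_cont ((a + b) / 2) w₁).continuousOn (s := Icc a b)
      apply intervalIntegral.integral_mono_on hle
      · apply ContinuousOn.intervalIntegrable
        rw [uIcc_of_le hle]
        fun_prop
      · apply ContinuousOn.intervalIntegrable
        rw [uIcc_of_le hle]
        fun_prop
      · intro x hx
        have t0 : 0 ≤ tentw ((a + b) / 2) w₁ x := tent_nonneg _
        have t1 : tentw ((a + b) / 2) w₁ x ≤ 1 := tent_le_one _
        set y := tentw ((a + b) / 2) w₁ x
        have hq : (1/2) * (3/2 * v x ^ 2 - lam) + (1/2) * v x * (c₁ * y) + (1/8) * (c₁ * y) ^ 2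
            ≤ - (γ / 4) := by
          have hcy : c₁ * y ≤ c₁ := by nlinarith
          have hcy0 : 0 ≤ c₁ * y := by positivity
          have g1 := hγv x hx
          have g2 : v x * (c₁ * y) ≤ κ * c₁ :=
            mul_le_mul ((le_abs_self _).trans (hvκ x hx).le) hcy hcy0 hκ0.le
          have g3 : (c₁ * y) ^ 2 ≤ c₁ ^ 2 := pow_le_pow_left₀ hcy0 hcy 2
          linarith
        have hq2 := mul_le_mul_of_nonneg_left hq (show 0 ≤ θ x * (c₁ * y) ^ 2 from
          mul_nonneg (hθ x hx).le (sq_nonneg _))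
        have hq3 := mul_le_mul_of_nonneg_right (hm' x hx)
          (show 0 ≤ (γ / 4) * (c₁ * y) ^ 2 by positivity)
        calc _ = θ x * (c₁ * y) ^ 2 * ((1/2) * (3/2 * v x ^ 2 - lam) + (1/2) * v x * (c₁ * y) + (1/8) * (c₁ * y) ^ 2) := by ring
          _ ≤ _ := hq2
          _ ≤ -(m * (γ / 4 * (c₁ * y) ^ 2)) := by linarith
          _ = _ := by ring
    rw [intervalIntegral.integral_const_mul, hi1 2 (by norm_num)] at hb
    have : 0 < m * (γ / 4) * c₁ ^ 2 * (w₁ * ∫ t, tent t ^ 2) := by positivity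
    linarith
  · have hd := Kf_diff hle hθc hFc hvc hC2.1 hcrit
    have htc := (tentw_cont ((a + b) / 2) w₂).continuousOn (s := Icc a b)
    have hint : ∀ (r : ℝ) (k : ℕ), IntervalIntegrable
        (fun x => r * (tentw ((a + b) / 2) w₂ x) ^ k) volume a b := by
      intro r k
      apply ContinuousOn.intervalIntegrable
      rw [uIcc_of_le hle]
      fun_prop
    have hb : (∫ x in a..b, (((m / 8 * c₂ ^ 4) * (tentw ((a + b) / 2) w₂ x) ^ 4
        - (T * κ / 2 * c₂ ^ 3) * (tentw ((a + b) / 2) w₂ x) ^ 3)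
        - (T * lam / 2 * c₂ ^ 2) * (tentw ((a + b) / 2) w₂ x) ^ 2)) ≤
        (∫ x in a..b, θ x * ((1/2) * (3/2 * v x ^ 2 - lam) * (c₂ * tentw ((a + b) / 2) w₂ x) ^ 2
        + (1/2) * v x * (c₂ * tentw ((a + b) / 2) w₂ x) ^ 3
        + (1/8) * (c₂ * tentw ((a + b) / 2) w₂ x) ^ 4)) := by
      have hcc := hC2.1
      apply intervalIntegral.integral_mono_on hle
      · exact ((hint _ _).sub (hint _ _)).sub (hint _ _)
      · apply ContinuousOn.intervalIntegrable
        rw [uIcc_of_le hle]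
        fun_prop
      · intro x hx
        have t0 : 0 ≤ tentw ((a + b) / 2) w₂ x := tent_nonneg _
        set y := tentw ((a + b) / 2) w₂ x
        have hcy0 : 0 ≤ c₂ * y := by positivity
        have hθx := (hθ x hx).le
        have g4 : m * (c₂ * y) ^ 4 ≤ θ x * (c₂ * y) ^ 4 :=
          mul_le_mul_of_nonneg_right (hm' x hx) (by positivity)
        have g3 : -(T * κ) * (c₂ * y) ^ 3 ≤ (θ x * v x) * (c₂ * y) ^ 3 := by
          apply mul_le_mul_of_nonneg_right _ (by positivity)
          have := (abs_lt.1 (hvκ x hx)).1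
          have e1 := mul_le_mul_of_nonneg_left this.le hθx
          have e2 := mul_le_mul_of_nonneg_right (hM' x hx) hκ0.le
          linarith
        have g2 : -(T * lam) * (c₂ * y) ^ 2 ≤ (θ x * (3/2 * v x ^ 2 - lam)) * (c₂ * y) ^ 2 := by
          apply mul_le_mul_of_nonneg_right _ (by positivity)
          have e1 := mul_nonneg hθx (sq_nonneg (v x))
          have e2 := mul_le_mul_of_nonneg_right (hM' x hx) hlam.le
          linarith
        linarith
    rw [intervalIntegral.integral_sub ((hint _ _).sub (hint _ _)) (hint _ _),
      intervalIntegral.integral_sub (hint _ _) (hint _ _),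
      intervalIntegral.integral_const_mul, intervalIntegral.integral_const_mul,
      intervalIntegral.integral_const_mul, hi2 2 (by norm_num), hi2 3 (by norm_num),
      hi2 4 (by norm_num)] at hb
    have := mul_pos hw₂ hc₂'
    linarith
end

section
/- Assume the function x ↦ θ(x)F(x) is differentiable on [a,b] with derivative −θf. Endow C¹[a,b] with the norm ‖u‖ := ‖u‖_∞ + ‖u'‖_∞ and C₀[a,b] with ‖·‖_∞. Let ū ∈ C_{1,0}[a,b] and set v̄ := ū'. Then the following assertions are equivalent: (i) ū is a local maximum point of J restricted to C_{1,0}[a,b]; (ii) ū is a local extremum point of J restricted to C_{1,0}[a,b]; (iii) v̄ is a stationary point of K, i.e. T_{v̄}(h) = 0 for all h ∈ C₀[a,b]; (iv) v̄ is a local extremum point of K; (v) v̄ is a local maximum point of K; (vi) v̄ = z₂ ∘ F; (vii) there exists u₀ ∈ ℝ such that ū(x) = u₀ + ∫_a^x z₂(F(ρ)) dρ for every x ∈ [a,b]. -/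
open Set MeasureTheory intervalIntegral

/-- `u ∈ C¹[a,b]` with derivative `u'` on `[a,b]`. -/
def IsC1 (a b : ℝ) (u u' : ℝ → ℝ) : Prop :=
  (∀ x ∈ Set.Icc a b, HasDerivWithinAt u (u' x) (Set.Icc a b) x) ∧
    ContinuousOn u' (Set.Icc a b)

/-- `u ∈ C_{1,0}[a,b]`: `u ∈ C¹[a,b]` (with derivative `u'`) and `u'(a) = u'(b) = 0`. -/
def C10 (a b : ℝ) (u u' : ℝ → ℝ) : Prop := IsC1 a b u u' ∧ u' a = 0 ∧ u' b = 0

/-- The functional `J(u) = ∫_a^b θ(x) (H(u'(x)) - f(x) u(x)) dx`,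
with `H(y) = (1/2)((1/2)y² - λ)²`. -/
noncomputable def Jf (a b lam : ℝ) (θ f : ℝ → ℝ) (u u' : ℝ → ℝ) : ℝ :=
  ∫ x in a..b, θ x * ((1/2) * ((1/2) * u' x ^ 2 - lam) ^ 2 - f x * u x)

/-- `v` is a local minimizer of `K` on `C₀[a,b]` w.r.t. the sup norm. -/
noncomputable def KlocMin (a b lam : ℝ) (θ F : ℝ → ℝ) (v : ℝ → ℝ) : Prop :=
  C0 a b v ∧ ∃ r > 0, ∀ w : ℝ → ℝ, C0 a b w → supN a b (w - v) < r →
    Kf a b lam θ F v ≤ Kf a b lam θ F w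

/-- `v` is a local maximizer of `K` on `C₀[a,b]` w.r.t. the sup norm. -/
noncomputable def KlocMax (a b lam : ℝ) (θ F : ℝ → ℝ) (v : ℝ → ℝ) : Prop :=
  C0 a b v ∧ ∃ r > 0, ∀ w : ℝ → ℝ, C0 a b w → supN a b (w - v) < r →
    Kf a b lam θ F w ≤ Kf a b lam θ F v

/-- `u` is a local minimizer of `J` restricted to `C_{1,0}[a,b]`,
w.r.t. the norm `‖u‖ = ‖u‖_∞ + ‖u'‖_∞` on `C¹[a,b]`. -/
noncomputable def JlocMin (a b lam : ℝ) (θ f : ℝ → ℝ) (u u' : ℝ → ℝ) : Prop :=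
  C10 a b u u' ∧ ∃ r > 0, ∀ w w' : ℝ → ℝ, C10 a b w w' →
    supN a b (w - u) + supN a b (w' - u') < r →
    Jf a b lam θ f u u' ≤ Jf a b lam θ f w w'

/-- `u` is a local maximizer of `J` restricted to `C_{1,0}[a,b]`,
w.r.t. the norm `‖u‖ = ‖u‖_∞ + ‖u'‖_∞` on `C¹[a,b]`. -/
noncomputable def JlocMax (a b lam : ℝ) (θ f : ℝ → ℝ) (u u' : ℝ → ℝ) : Prop :=
  C10 a b u u' ∧ ∃ r > 0, ∀ w w' : ℝ → ℝ, C10 a b w w' →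
    supN a b (w - u) + supN a b (w' - u') < r →
    Jf a b lam θ f w w' ≤ Jf a b lam θ f u u'

/-- The linear functional `T_v(h) = ∫_a^b θ(x)(v(x)((1/2)v(x)² - λ) - F(x)) h(x) dx`. -/
noncomputable def Tf (a b lam : ℝ) (θ F : ℝ → ℝ) (v h : ℝ → ℝ) : ℝ :=
  ∫ x in a..b, θ x * (v x * ((1/2) * v x ^ 2 - lam) - F x) * h x

theorem aux_cont_int {a b : ℝ} (hab : a < b) {g : ℝ → ℝ} (hg : ContinuousOn g (Set.Icc a b)) :
    IntervalIntegrable g volume a b := by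
  apply ContinuousOn.intervalIntegrable
  rwa [Set.uIcc_of_le hab.le]

theorem aux_ftc {a b : ℝ} (hab : a < b) {g : ℝ → ℝ} (hg : ContinuousOn g (Set.Icc a b)) :
    ∀ x ∈ Set.Icc a b,
      HasDerivWithinAt (fun x => ∫ t in a..x, g t) (g x) (Set.Icc a b) x := by
  intro x hx
  have hc : Continuous (Set.IccExtend hab.le ((Set.Icc a b).domRestrict g)) :=
    (continuousOn_iff_continuous_domRestrict.mp hg).Icc_extend'
  have he : ∀ y ∈ Set.Icc a b, Set.IccExtend hab.le ((Set.Icc a b).domRestrict g) y = g y := by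
    intro y hy
    rw [Set.IccExtend_of_mem _ _ hy]
    rfl
  have h1 := (intervalIntegral.integral_hasDerivAt_right (hc.intervalIntegrable a x)
    (hc.stronglyMeasurableAtFilter _ _) hc.continuousAt).hasDerivWithinAt (s := Set.Icc a b)
  rw [he x hx] at h1
  have hee : ∀ y ∈ Set.Icc a b, (∫ t in a..y, g t) =
      ∫ t in a..y, Set.IccExtend hab.le ((Set.Icc a b).domRestrict g) t := by
    intro y hy
    apply intervalIntegral.integral_congr
    intro t ht
    rw [Set.uIcc_of_le hy.1] at ht
    exact (he t ⟨ht.1, ht.2.trans hy.2⟩).symm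
  exact h1.congr hee (hee x hx)

theorem aux_c1 {a b : ℝ} (hab : a < b) {u v : ℝ → ℝ} (h : IsC1 a b u v) :
    ∀ x ∈ Set.Icc a b, u x = u a + ∫ t in a..x, v t := by
  intro x hx
  have hsub : Set.Icc a x ⊆ Set.Icc a b := Set.Icc_subset_Icc_right hx.2
  have huc : ContinuousOn u (Set.Icc a b) := fun y hy => (h.1 y hy).continuousWithinAt
  have := intervalIntegral.integral_eq_sub_of_hasDerivAt_of_le (f := u) (f' := v) hx.1
    (huc.mono hsub) (fun y hy => (h.1 y (hsub ⟨hy.1.le, hy.2.le⟩)).hasDerivAt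
      (Icc_mem_nhds hy.1 (hy.2.trans_le hx.2)))
    (by
      apply ContinuousOn.intervalIntegrable
      rw [Set.uIcc_of_le hx.1]
      exact h.2.mono hsub)
  rw [this]; ring

theorem aux_le_supN {a b : ℝ} {h : ℝ → ℝ} (hc : ContinuousOn h (Set.Icc a b)) :
    ∀ x ∈ Set.Icc a b, |h x| ≤ supN a b h := by
  intro x hx
  exact le_csSup (isCompact_Icc.image_of_continuousOn hc.abs).bddAbove ⟨x, hx, rfl⟩

theorem aux_supN_le {a b : ℝ} (hab : a < b) {h : ℝ → ℝ} {M : ℝ}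
    (hM : ∀ x ∈ Set.Icc a b, |h x| ≤ M) : supN a b h ≤ M := by
  apply csSup_le
  · exact ⟨_, a, ⟨le_refl a, hab.le⟩, rfl⟩
  · rintro _ ⟨x, hx, rfl⟩
    exact hM x hx

theorem aux_supN_nonneg {a b : ℝ} (h : ℝ → ℝ) : 0 ≤ supN a b h := by
  apply Real.sSup_nonneg
  rintro _ ⟨x, hx, rfl⟩
  exact abs_nonneg _

theorem aux_JK {a b lam : ℝ} (hab : a < b)
    {θ : ℝ → ℝ} (hθc : ContinuousOn θ (Set.Icc a b))
    {f : ℝ → ℝ} (hf : ContinuousOn f (Set.Icc a b))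
    {F : ℝ → ℝ} (hF : ContinuousOn F (Set.Icc a b)) (hFa : F a = 0) (hFb : F b = 0)
    (hθF : ∀ x ∈ Set.Icc a b,
      HasDerivWithinAt (fun t => θ t * F t) (-(θ x * f x)) (Set.Icc a b) x)
    {u v : ℝ → ℝ} (h : IsC1 a b u v) : Jf a b lam θ f u v = Kf a b lam θ F v := by
  have huc : ContinuousOn u (Set.Icc a b) := fun y hy => (h.1 y hy).continuousWithinAt
  have hvc := h.2
  have key := intervalIntegral.integral_eq_sub_of_hasDerivAt_of_le
    (f := fun t => (θ t * F t) * u t) (f' := fun t => -(θ t * f t) * u t + (θ t * F t) * v t) hab.le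
    (by fun_prop) (fun y hy =>
      ((hθF y ⟨hy.1.le, hy.2.le⟩).hasDerivAt (Icc_mem_nhds hy.1 hy.2)).mul
      ((h.1 y ⟨hy.1.le, hy.2.le⟩).hasDerivAt (Icc_mem_nhds hy.1 hy.2)))
    (aux_cont_int hab (by fun_prop))
  simp only [hFa, hFb, mul_zero, zero_mul, sub_zero] at key
  have h2 : Jf a b lam θ f u v - Kf a b lam θ F v = 0 := by
    unfold Jf Kf
    rw [← intervalIntegral.integral_sub (aux_cont_int hab (by fun_prop))
      (aux_cont_int hab (by fun_prop)), ← key]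
    apply intervalIntegral.integral_congr
    intro x _
    simp only
    ring
  linarith

theorem aux_expand {a b lam : ℝ} (hab : a < b)
    {θ : ℝ → ℝ} (hθc : ContinuousOn θ (Set.Icc a b))
    {F : ℝ → ℝ} (hF : ContinuousOn F (Set.Icc a b))
    {v h : ℝ → ℝ} (hv : ContinuousOn v (Set.Icc a b)) (hh : ContinuousOn h (Set.Icc a b)) :
    ∃ A B C : ℝ, ∀ t : ℝ, Kf a b lam θ F (fun x => v x + t * h x) =
      Kf a b lam θ F v + t * Tf a b lam θ F v h + t ^ 2 * A + t ^ 3 * B + t ^ 4 * C := by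
  refine ⟨∫ x in a..b, θ x * ((3/4 * v x ^ 2 - lam / 2) * h x ^ 2),
    ∫ x in a..b, θ x * (1/2 * v x * h x ^ 3), ∫ x in a..b, θ x * (1/8 * h x ^ 4), ?_⟩
  intro t
  unfold Kf Tf
  simp only [← intervalIntegral.integral_const_mul]
  rw [← intervalIntegral.integral_add (aux_cont_int hab (by fun_prop))
      (aux_cont_int hab (by fun_prop)), ← intervalIntegral.integral_add
      (aux_cont_int hab (by fun_prop)) (aux_cont_int hab (by fun_prop)),
      ← intervalIntegral.integral_add
      (aux_cont_int hab (by fun_prop)) (aux_cont_int hab (by fun_prop)),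
      ← intervalIntegral.integral_add
      (aux_cont_int hab (by fun_prop)) (aux_cont_int hab (by fun_prop))]
  apply intervalIntegral.integral_congr
  intro x _
  simp only
  ring

theorem aux_poly_deriv (k T A B C : ℝ) :
    HasDerivAt (fun t : ℝ => k + t * T + t ^ 2 * A + t ^ 3 * B + t ^ 4 * C) T 0 := by
  have h := ((((hasDerivAt_const (0:ℝ) k).add ((hasDerivAt_id (0:ℝ)).mul_const T)).add
    ((hasDerivAt_pow 2 (0:ℝ)).mul_const A)).add ((hasDerivAt_pow 3 (0:ℝ)).mul_const B)).add
    ((hasDerivAt_pow 4 (0:ℝ)).mul_const C)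
  have e : 0 + 1 * T + ((2:ℕ):ℝ) * 0 ^ (2 - 1) * A + ((3:ℕ):ℝ) * 0 ^ (3 - 1) * B
      + ((4:ℕ):ℝ) * 0 ^ (4 - 1) * C = T := by norm_num
  rw [e] at h
  exact h

theorem aux_stat {a b lam : ℝ} (hab : a < b)
    {θ : ℝ → ℝ} (hθc : ContinuousOn θ (Set.Icc a b))
    {F : ℝ → ℝ} (hF : ContinuousOn F (Set.Icc a b)) {v : ℝ → ℝ}
    (hK : KlocMin a b lam θ F v ∨ KlocMax a b lam θ F v) :
    ∀ h : ℝ → ℝ, C0 a b h → Tf a b lam θ F v h = 0 := by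
  intro h hh
  have hv : C0 a b v := by
    rcases hK with hK | hK <;> exact hK.1
  obtain ⟨A, B, C, hE⟩ := aux_expand (lam := lam) hab hθc hF hv.1 hh.1
  have hD := aux_poly_deriv (Kf a b lam θ F v) (Tf a b lam θ F v h) A B C
  have hw : ∀ t : ℝ, C0 a b (fun x => v x + t * h x) := by
    intro t
    have h1 := hv.1
    have h2 := hh.1
    refine ⟨by fun_prop, ?_, ?_⟩
    · simp [hv.2.1, hh.2.1]
    · simp [hv.2.2, hh.2.2]
  have hs : ∀ r > 0, ∀ᶠ t : ℝ in nhds 0, supN a b ((fun x => v x + t * h x) - v) < r := by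
    intro r hr
    have hct : Filter.Tendsto (fun t : ℝ => |t| * supN a b h) (nhds 0) (nhds 0) := by
      have : Continuous (fun t : ℝ => |t| * supN a b h) := by fun_prop
      simpa using this.tendsto 0
    filter_upwards [hct.eventually (gt_mem_nhds hr)] with t ht
    refine lt_of_le_of_lt (aux_supN_le hab ?_) ht
    intro x hx
    simp only [Pi.sub_apply, add_sub_cancel_left, abs_mul]
    exact mul_le_mul_of_nonneg_left (aux_le_supN hh.1 x hx) (abs_nonneg t)
  rcases hK with ⟨_, r, hr, hK⟩ | ⟨_, r, hr, hK⟩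
  · refine IsLocalMin.hasDerivAt_eq_zero (a := (0:ℝ)) ?_ hD
    filter_upwards [hs r hr] with t ht
    have := hK _ (hw t) ht
    rw [hE] at this
    simpa using this
  · refine IsLocalMax.hasDerivAt_eq_zero (a := (0:ℝ)) ?_ hD
    filter_upwards [hs r hr] with t ht
    have := hK _ (hw t) ht
    rw [hE] at this
    simpa using this

theorem aux_EL {a b lam : ℝ} (hab : a < b)
    {θ : ℝ → ℝ} (hθc : ContinuousOn θ (Set.Icc a b)) (hθ : ∀ x ∈ Set.Icc a b, 0 < θ x)
    {F : ℝ → ℝ} (hF : ContinuousOn F (Set.Icc a b)) (hFa : F a = 0) (hFb : F b = 0)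
    {v : ℝ → ℝ} (hv : C0 a b v)
    (hT : ∀ h : ℝ → ℝ, C0 a b h → Tf a b lam θ F v h = 0) :
    ∀ x ∈ Set.Icc a b, v x * ((1/2) * v x ^ 2 - lam) = F x := by
  have h1 := hv.1
  have h0 := hT (fun x => v x * ((1/2) * v x ^ 2 - lam) - F x)
    ⟨by fun_prop, by simp [hv.2.1, hFa], by simp [hv.2.2, hFb]⟩
  unfold Tf at h0
  by_contra! hne
  obtain ⟨c, hc, hne⟩ := hne
  have : 0 < ∫ x in a..b, θ x * (v x * ((1/2) * v x ^ 2 - lam) - F x) *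
      (v x * ((1/2) * v x ^ 2 - lam) - F x) := by
    apply intervalIntegral.integral_pos hab (by fun_prop)
    · intro x hx
      rw [mul_assoc]
      exact mul_nonneg (hθ x ⟨hx.1.le, hx.2⟩).le (mul_self_nonneg _)
    · refine ⟨c, hc, ?_⟩
      rw [mul_assoc]
      exact mul_pos (hθ c hc) (mul_self_pos.mpr (sub_ne_zero.mpr hne))
  linarith

theorem aux_santi {lam κ : ℝ} (hκ2 : κ ^ 2 = 2 * lam / 3) {x y : ℝ}
    (hx : -κ ≤ x) (hxy : x < y) (hy : y ≤ κ) :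
    y * ((1/2) * y ^ 2 - lam) < x * ((1/2) * x ^ 2 - lam) := by
  have h : x ^ 2 + x * y + y ^ 2 < 3 * κ ^ 2 := by
    nlinarith [sq_nonneg (x - y), mul_pos (sub_pos.mpr hxy) (sub_pos.mpr hxy),
      mul_nonneg (sub_nonneg.mpr hy) (by linarith : 0 ≤ κ + y),
      mul_nonneg (by linarith : 0 ≤ κ - x) (by linarith : 0 ≤ κ + x)]
  have : x * ((1/2) * x ^ 2 - lam) - y * ((1/2) * y ^ 2 - lam)
      = (y - x) * (lam - (x ^ 2 + x * y + y ^ 2) / 2) := by ring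
  have h3 : 0 < (y - x) * (lam - (x ^ 2 + x * y + y ^ 2) / 2) :=
    mul_pos (by linarith) (by linarith)
  linarith

theorem aux_zcont {lam κ : ℝ} (hκ2 : κ ^ 2 = 2 * lam / 3) {z₂ : ℝ → ℝ}
    (hz₂ : ∀ A ∈ Set.Ioo (-κ ^ 3) (κ ^ 3),
      z₂ A ∈ Set.Ioo (-κ) κ ∧ z₂ A * ((1/2) * (z₂ A) ^ 2 - lam) = A ∧
      ∀ z ∈ Set.Ioo (-κ) κ, z * ((1/2) * z ^ 2 - lam) = A → z = z₂ A) :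
    ContinuousOn z₂ (Set.Ioo (-κ ^ 3) (κ ^ 3)) := by
  intro A hA
  apply ContinuousAt.continuousWithinAt
  have hneg : ContinuousAt (fun A => - z₂ A) A := by
    apply continuousAt_of_monotoneOn_of_image_mem_nhds (s := Set.Ioo (-κ ^ 3) (κ ^ 3))
    · intro x hx y hy hxy
      simp only [neg_le_neg_iff]
      by_contra! hlt
      have := aux_santi hκ2 (hz₂ x hx).1.1.le hlt (hz₂ y hy).1.2.le
      rw [(hz₂ x hx).2.1, (hz₂ y hy).2.1] at this
      linarith
    · exact Ioo_mem_nhds hA.1 hA.2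
    · have hzA := (hz₂ A hA).1
      refine Filter.mem_of_superset (Ioo_mem_nhds (a := -κ) (b := κ)
        (by linarith [hzA.2]) (by linarith [hzA.1])) ?_
      intro z hz
      have h1 := aux_santi hκ2 le_rfl (x := -κ) (y := -z) (by linarith [hz.2])
        (by linarith [hz.1])
      have h2 := aux_santi hκ2 (x := -z) (y := κ) (by linarith [hz.2]) (by linarith [hz.1]) le_rfl
      have e1 : κ * ((1/2) * κ ^ 2 - lam) = -κ ^ 3 := by
        have : lam = 3 / 2 * κ ^ 2 := by linarith
        rw [this]; ring
      have e2 : -κ * ((1/2) * (-κ) ^ 2 - lam) = κ ^ 3 := by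
        have : lam = 3 / 2 * κ ^ 2 := by linarith
        rw [this]; ring
      rw [e2] at h1
      rw [e1] at h2
      refine ⟨_, ⟨h2, h1⟩, ?_⟩
      have := (hz₂ _ ⟨h2, h1⟩).2.2 (-z) ⟨by linarith [hz.2], by linarith [hz.1]⟩ rfl
      simp only
      rw [← this]; ring
  have h2 := hneg.neg
  have h3 : (-fun A => - z₂ A) = z₂ := by
    funext x
    simp
  rwa [h3] at h2

theorem aux_max_pt {lam κ v w F : ℝ} (hκ2 : κ ^ 2 = 2 * lam / 3)
    (hv : |v| ≤ κ) (hw : |w| ≤ κ) (h : v * ((1/2) * v ^ 2 - lam) = F) :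
    (1/2) * ((1/2) * w ^ 2 - lam) ^ 2 - F * w ≤ (1/2) * ((1/2) * v ^ 2 - lam) ^ 2 - F * v := by
  rw [abs_le] at hv hw
  have hv2 : v ^ 2 ≤ κ ^ 2 := sq_le_sq' hv.1 hv.2
  have hw2 : w ^ 2 ≤ κ ^ 2 := sq_le_sq' hw.1 hw.2
  have h1 : (w ^ 2 + 2 * w * v + 3 * v ^ 2) / 8 - lam / 2 ≤ 0 := by
    nlinarith [sq_nonneg (w - v)]
  have h2 := mul_nonneg (sq_nonneg (w - v)) (neg_nonneg.mpr h1)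
  rw [← h]
  nlinarith

theorem stmt12 (a b lam : ℝ) (hab : a < b) (hlam : 0 < lam)
    (θ : ℝ → ℝ) (hθc : ContinuousOn θ (Set.Icc a b)) (hθ : ∀ x ∈ Set.Icc a b, 0 < θ x)
    (f : ℝ → ℝ) (hf : ContinuousOn f (Set.Icc a b))
    (F : ℝ → ℝ) (hF : ContDiffOn ℝ 1 F (Set.Icc a b)) (hFa : F a = 0) (hFb : F b = 0)
    (hFne : ∀ x ∈ Set.Ioo a b, F x ≠ 0)
    (hFsmall : supN a b F < (2 * lam / 3) ^ ((3 : ℝ) / 2))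
    (hθF : ∀ x ∈ Set.Icc a b,
      HasDerivWithinAt (fun t => θ t * F t) (-(θ x * f x)) (Set.Icc a b) x)
    (κ : ℝ) (hκ : κ = Real.sqrt (2 * lam / 3))
    (z₂ : ℝ → ℝ)
    (hz₂ : ∀ A ∈ Set.Ioo (-κ ^ 3) (κ ^ 3),
      z₂ A ∈ Set.Ioo (-κ) κ ∧ z₂ A * ((1/2) * (z₂ A) ^ 2 - lam) = A ∧
      ∀ z ∈ Set.Ioo (-κ) κ, z * ((1/2) * z ^ 2 - lam) = A → z = z₂ A)
    (u v : ℝ → ℝ) (hu : C10 a b u v) :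
    [ JlocMax a b lam θ f u v,
      JlocMin a b lam θ f u v ∨ JlocMax a b lam θ f u v,
      ∀ h : ℝ → ℝ, C0 a b h → Tf a b lam θ F v h = 0,
      KlocMin a b lam θ F v ∨ KlocMax a b lam θ F v,
      KlocMax a b lam θ F v,
      ∀ x ∈ Set.Icc a b, v x = z₂ (F x),
      ∃ u₀ : ℝ, ∀ x ∈ Set.Icc a b, u x = u₀ + ∫ ρ in a..x, z₂ (F ρ) ].TFAE := by
  have hFc : ContinuousOn F (Set.Icc a b) := hF.continuousOn
  have hpos : 0 < 2 * lam / 3 := by positivity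
  have hκ0 : 0 < κ := by rw [hκ]; exact Real.sqrt_pos.mpr hpos
  have hκ2 : κ ^ 2 = 2 * lam / 3 := by rw [hκ]; exact Real.sq_sqrt hpos.le
  have hκ3 : (2 * lam / 3) ^ ((3 : ℝ) / 2) = κ ^ 3 := by
    rw [hκ, Real.sqrt_eq_rpow, ← Real.rpow_natCast, ← Real.rpow_mul hpos.le]
    norm_num
  have hFI : ∀ x ∈ Set.Icc a b, F x ∈ Set.Ioo (-κ ^ 3) (κ ^ 3) := by
    intro x hx
    have := (aux_le_supN hFc x hx).trans_lt hFsmall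
    rw [hκ3, abs_lt] at this
    exact this
  have hzF : ContinuousOn (fun x => z₂ (F x)) (Set.Icc a b) :=
    (aux_zcont hκ2 hz₂).comp hFc hFI
  have hvc : ContinuousOn v (Set.Icc a b) := hu.1.2
  have hv0 : C0 a b v := ⟨hvc, hu.2⟩
  have huc : ContinuousOn u (Set.Icc a b) := fun y hy => (hu.1.1 y hy).continuousWithinAt
  have hJK : ∀ w w' : ℝ → ℝ, C10 a b w w' → Jf a b lam θ f w w' = Kf a b lam θ F w' :=
    fun w w' hw => aux_JK hab hθc hf hFc hFa hFb hθF hw.1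
  have lift : ∀ r > 0, ∃ r' > 0, ∀ w : ℝ → ℝ, C0 a b w → supN a b (w - v) < r' →
      ∃ W : ℝ → ℝ, C10 a b W w ∧ supN a b (W - u) + supN a b (w - v) < r := by
    intro r hr
    have hba : 0 < b - a := sub_pos.mpr hab
    refine ⟨r / (1 + (b - a)), by positivity, ?_⟩
    intro w hw hs
    refine ⟨fun x => u a + ∫ t in a..x, w t,
      ⟨⟨fun x hx => (aux_ftc hab hw.1 x hx).const_add (u a), hw.1⟩, hw.2⟩, ?_⟩
    have hb : supN a b ((fun x => u a + ∫ t in a..x, w t) - u) ≤ supN a b (w - v) * (b - a) := by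
      apply aux_supN_le hab
      intro x hx
      have hsub : Set.Icc a x ⊆ Set.Icc a b := Set.Icc_subset_Icc_right hx.2
      have hi : ∀ g : ℝ → ℝ, ContinuousOn g (Set.Icc a b) → IntervalIntegrable g volume a x := by
        intro g hg
        apply ContinuousOn.intervalIntegrable
        rw [Set.uIcc_of_le hx.1]
        exact hg.mono hsub
      have e : ((fun x => u a + ∫ t in a..x, w t) - u) x = ∫ t in a..x, (w t - v t) := by
        rw [intervalIntegral.integral_sub (hi w hw.1) (hi v hvc)]
        simp only [Pi.sub_apply]
        rw [aux_c1 hab hu.1 x hx]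
        ring
      rw [e]
      have hn := intervalIntegral.norm_integral_le_of_norm_le_const (a := a) (b := x)
        (f := fun t => w t - v t) (C := supN a b (w - v)) (by
          intro t ht
          rw [Set.uIoc_of_le hx.1] at ht
          exact aux_le_supN (hw.1.sub hvc) t ⟨ht.1.le, ht.2.trans hx.2⟩)
      rw [Real.norm_eq_abs, abs_of_nonneg (sub_nonneg.mpr hx.1)] at hn
      exact hn.trans (mul_le_mul_of_nonneg_left (by linarith [hx.2]) (aux_supN_nonneg _))
    rw [lt_div_iff₀ (by positivity)] at hs
    linarith
  tfae_have 1 → 2 := Or.inr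
  tfae_have 2 → 4 := by
    rintro (⟨_, r, hr, h⟩ | ⟨_, r, hr, h⟩)
    · obtain ⟨r', hr', hl⟩ := lift r hr
      refine Or.inl ⟨hv0, r', hr', fun w hw hs => ?_⟩
      obtain ⟨W, hW, hWs⟩ := hl w hw hs
      have := h W w hW hWs
      rwa [hJK _ _ hW, hJK _ _ hu] at this
    · obtain ⟨r', hr', hl⟩ := lift r hr
      refine Or.inr ⟨hv0, r', hr', fun w hw hs => ?_⟩
      obtain ⟨W, hW, hWs⟩ := hl w hw hs
      have := h W w hW hWs
      rwa [hJK _ _ hW, hJK _ _ hu] at this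
  tfae_have 4 → 3 := aux_stat hab hθc hFc
  tfae_have 3 → 6 := by
    intro hT
    have hEL := aux_EL hab hθc hθ hFc hFa hFb hv0 hT
    have hlam' : lam = 3 / 2 * κ ^ 2 := by linarith
    have hne : ∀ x ∈ Set.Icc a b, |v x| ≠ κ := by
      intro x hx hk
      have h1 := hEL x hx
      have h2 := hFI x hx
      rcases (abs_eq hκ0.le).mp hk with h | h
      · rw [h, hlam'] at h1
        have : F x = -κ ^ 3 := by rw [← h1]; ring
        linarith [h2.1]
      · rw [h, hlam'] at h1
        have : F x = κ ^ 3 := by rw [← h1]; ring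
        linarith [h2.2]
    intro x hx
    have hlt : |v x| < κ := by
      by_contra! hge
      have hsub : Set.Icc a x ⊆ Set.Icc a b := Set.Icc_subset_Icc_right hx.2
      obtain ⟨y, hy, hyk⟩ := intermediate_value_Icc hx.1 (hvc.abs.mono hsub)
        (show κ ∈ Set.Icc |v a| |v x| from ⟨by rw [hu.2.1, abs_zero]; exact hκ0.le, hge⟩)
      exact hne y (hsub hy) hyk
    exact (hz₂ _ (hFI x hx)).2.2 (v x) (abs_lt.mp hlt) (hEL x hx)
  tfae_have 6 → 5 := by
    intro h6
    have hlt : ∀ x ∈ Set.Icc a b, |v x| < κ := by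
      intro x hx
      rw [h6 x hx]
      exact abs_lt.mpr (hz₂ _ (hFI x hx)).1
    obtain ⟨c, hc, hmax⟩ := isCompact_Icc.exists_isMaxOn
      (⟨a, le_refl a, hab.le⟩ : (Set.Icc a b).Nonempty) hvc.abs
    refine ⟨hv0, κ - |v c|, sub_pos.mpr (hlt c hc), ?_⟩
    intro w hw hs
    have hwc := hw.1
    apply intervalIntegral.integral_mono_on hab.le (aux_cont_int hab (by fun_prop))
      (aux_cont_int hab (by fun_prop))
    intro x hx
    apply mul_le_mul_of_nonneg_left _ (hθ x hx).le
    apply aux_max_pt hκ2 (hlt x hx).le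
    · have h1 : |w x - v x| ≤ supN a b (w - v) := aux_le_supN (hw.1.sub hvc) x hx
      have h2 : |v x| ≤ |v c| := hmax hx
      have h3 : |w x| ≤ |w x - v x| + |v x| := by
        simpa using abs_add_le (w x - v x) (v x)
      linarith
    · rw [h6 x hx]
      exact (hz₂ _ (hFI x hx)).2.1
  tfae_have 5 → 4 := Or.inr
  tfae_have 5 → 1 := by
    rintro ⟨_, r, hr, h⟩
    refine ⟨hu, r, hr, fun w w' hw hs => ?_⟩
    rw [hJK _ _ hw, hJK _ _ hu]
    exact h w' ⟨hw.1.2, hw.2⟩ (by linarith [aux_supN_nonneg (a := a) (b := b) (w - u)])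
  tfae_have 6 → 7 := by
    intro h6
    refine ⟨u a, fun x hx => ?_⟩
    rw [aux_c1 hab hu.1 x hx]
    congr 1
    apply intervalIntegral.integral_congr
    intro t ht
    rw [Set.uIcc_of_le hx.1] at ht
    exact h6 t ⟨ht.1, ht.2.trans hx.2⟩
  tfae_have 7 → 6 := by
    rintro ⟨u₀, h7⟩ x hx
    have h1 := ((aux_ftc hab hzF x hx).const_add u₀).congr h7 (h7 x hx)
    exact (uniqueDiffOn_Icc hab x hx).eq_deriv _ (hu.1.1 x hx) h1
  tfae_finish
end
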